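/- arXiv:2603.02107 — 7 statements merged into one kernel-verified Lean document; each statement's English description precedes it below -/
import Mathlib

section
/- Let α ∈ ℝ and let I ⊆ ℝ be a nonempty open interval. Suppose y : I → ℝ is smooth, y(x) > 0 for all x ∈ I, and y satisfies the Euclidean α-catenary equation y''(x)·y(x) = α·(1 + y'(x)²) on I. Then there exists a constant c > 0 such that for all x ∈ I both 1 + y'(x)² = c²·y(x)^(2α) and y''(x) = α·c²·y(x)^(2α−1) hold (powers are real powers of the positive number y(x)). -/
/-- First integral of the α-catenary equation: `(1 + y'²) · y^(-2α)` has zero derivative. -/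
theorem hasDerivAt_catenary_first_integral {α x v : ℝ} {y p : ℝ → ℝ}
    (hy : HasDerivAt y (p x) x) (hp : HasDerivAt p v x) (hpos : 0 < y x)
    (hcat : v * y x = α * (1 + p x ^ 2)) :
    HasDerivAt (fun t => (1 + p t ^ 2) * y t ^ (-(2 * α))) 0 x := by
  have h := ((hp.pow 2).const_add 1).mul (hy.rpow_const (p := -(2 * α)) (Or.inl hpos.ne'))
  refine h.congr_deriv ?_
  have hsplit : y x ^ (-(2 * α)) = y x ^ (-(2 * α) - 1) * y x := by
    rw [Real.rpow_sub_one hpos.ne', div_mul_cancel₀ _ hpos.ne']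
  simp only [Pi.pow_apply, hsplit]
  push_cast
  linear_combination 2 * p x * y x ^ (-(2 * α) - 1) * hcat

/-- If `y > 0` is smooth on a nonempty open interval `I` and satisfies the
Euclidean α-catenary equation `y'' · y = α · (1 + y'²)` on `I`, then there is a constant
`c > 0` with `1 + y'² = c² · y^(2α)` and `y'' = α · c² · y^(2α-1)` on `I`. -/
theorem statement_0 (α : ℝ) (I : Set ℝ) (hIopen : IsOpen I) (hIne : I.Nonempty)
    (hIord : I.OrdConnected) (y : ℝ → ℝ) (hy : ContDiffOn ℝ (⊤ : ℕ∞) y I)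
    (hypos : ∀ x ∈ I, 0 < y x)
    (hcat : ∀ x ∈ I, deriv (deriv y) x * y x = α * (1 + (deriv y x) ^ 2)) :
    ∃ c : ℝ, 0 < c ∧ ∀ x ∈ I,
      1 + (deriv y x) ^ 2 = c ^ 2 * y x ^ (2 * α) ∧
      deriv (deriv y) x = α * c ^ 2 * y x ^ (2 * α - 1) := by
  obtain ⟨x₀, hx₀⟩ := hIne
  have hderiv : DifferentiableOn ℝ (deriv y) I :=
    (hy.deriv_of_isOpen (m := 1) hIopen (by norm_cast)).differentiableOn (by simp)
  set g : ℝ → ℝ := fun t => (1 + deriv y t ^ 2) * y t ^ (-(2 * α)) with hg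
  have hg0 : ∀ x ∈ I, HasDerivAt g 0 x := fun x hx =>
    have hnhds := hIopen.mem_nhds hx
    hasDerivAt_catenary_first_integral
      ((hy.differentiableOn (by simp)).differentiableAt hnhds).hasDerivAt
      (hderiv.differentiableAt hnhds).hasDerivAt (hypos x hx) (hcat x hx)
  have hconst : ∀ x ∈ I, g x = g x₀ := fun x hx =>
    hIopen.is_const_of_deriv_eq_zero hIord.isPreconnected
      (fun t ht => (hg0 t ht).differentiableAt.differentiableWithinAt)
      (fun t ht => (hg0 t ht).deriv) hx hx₀
  have hgpos : 0 < g x₀ :=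
    mul_pos (by positivity) (Real.rpow_pos_of_pos (hypos x₀ hx₀) _)
  refine ⟨√(g x₀), Real.sqrt_pos.2 hgpos, fun x hx => ?_⟩
  have hyx := hypos x hx
  rw [Real.sq_sqrt hgpos.le]
  have hfirst : 1 + deriv y x ^ 2 = g x₀ * y x ^ (2 * α) := by
    rw [← hconst x hx, hg]
    simp only
    rw [mul_assoc, ← Real.rpow_add hyx, neg_add_cancel, Real.rpow_zero, mul_one]
  refine ⟨hfirst, ?_⟩
  rw [Real.rpow_sub_one hyx.ne', ← mul_div_assoc, eq_div_iff hyx.ne', hcat x hx, hfirst,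
    ← mul_assoc]
end

section
/- Let I ⊆ ℝ be a nonempty open interval, v ∈ ℝ, and let y, w, z : I → ℝ be smooth with y(x) > 0 on I. Then the three conditions (i) y''(x)·y(x) = 1 + y'(x)², (ii) z''(x) + (y'(x)/y(x))·(z'(x) + v) + (z(x) + v·x)/y(x)² = 0, and (iii) w'(x) + y'(x)·z'(x) = 0 hold for all x ∈ I if and only if there exist constants c > 0 and m, d₁, d₂, d₃ ∈ ℝ such that for all x ∈ I: y(x) = (1/c)·cosh(c·x+m), z(x) = −v·x + d₁·sech(c·x+m) + d₂·tanh(c·x+m), and w(x) = (v/c)·cosh(c·x+m) + c·d₁·x − d₁·tanh(c·x+m) + d₂·sech(c·x+m) + d₃, where sech(t) = 1/cosh(t). -/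
theorem exists_eq_const_of_hasDerivAt_zero {I : Set ℝ} (hI : IsOpen I) (hIord : I.OrdConnected)
    {f : ℝ → ℝ} (hf : ∀ x ∈ I, HasDerivAt f 0 x) : ∃ c, ∀ x ∈ I, f x = c :=
  hI.exists_is_const_of_deriv_eq_zero hIord.isPreconnected
    (fun x hx => (hf x hx).differentiableAt.differentiableWithinAt)
    (fun x hx => (hf x hx).deriv)

theorem hasDerivAt_affine (c m x : ℝ) : HasDerivAt (fun t => c * t + m) c x := by
  simpa using ((hasDerivAt_id x).const_mul c).add_const m

theorem hasDerivAt_cosh_affine (c m x : ℝ) :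
    HasDerivAt (fun t => Real.cosh (c * t + m)) (c * Real.sinh (c * x + m)) x := by
  simpa [mul_comm] using (hasDerivAt_affine c m x).cosh

theorem hasDerivAt_sinh_affine (c m x : ℝ) :
    HasDerivAt (fun t => Real.sinh (c * t + m)) (c * Real.cosh (c * x + m)) x := by
  simpa [mul_comm] using (hasDerivAt_affine c m x).sinh

theorem hasDerivAt_sech_affine (c m x : ℝ) :
    HasDerivAt (fun t => (Real.cosh (c * t + m))⁻¹)
      (-(c * Real.sinh (c * x + m)) / Real.cosh (c * x + m) ^ 2) x :=
  (hasDerivAt_cosh_affine c m x).inv (Real.cosh_pos _).ne'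

theorem hasDerivAt_tanh_affine (c m x : ℝ) :
    HasDerivAt (fun t => Real.tanh (c * t + m)) (c / Real.cosh (c * x + m) ^ 2) x := by
  have h := (hasDerivAt_sinh_affine c m x).div (hasDerivAt_cosh_affine c m x) (Real.cosh_pos _).ne'
  have e : (fun t => Real.tanh (c * t + m)) =
      (fun t => Real.sinh (c * t + m)) / fun t => Real.cosh (c * t + m) := by
    ext t; simp [Real.tanh_eq_sinh_div_cosh]
  rw [e]
  refine h.congr_deriv ?_
  congr 1
  linear_combination c * Real.cosh_sq_sub_sinh_sq (c * x + m)

theorem exists_eq_cosh_of_catenary {I : Set ℝ} (hI : IsOpen I) (hIne : I.Nonempty)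
    (hIord : I.OrdConnected) {y y' y'' : ℝ → ℝ} (hy : ∀ x ∈ I, HasDerivAt y (y' x) x)
    (hy' : ∀ x ∈ I, HasDerivAt y' (y'' x) x) (hypos : ∀ x ∈ I, 0 < y x)
    (h : ∀ x ∈ I, y'' x * y x = 1 + y' x ^ 2) :
    ∃ c m : ℝ, 0 < c ∧ ∀ x ∈ I,
      y x = (1 / c) * Real.cosh (c * x + m) ∧ y' x = Real.sinh (c * x + m) := by
  have hs : ∀ x, 0 < √(1 + y' x ^ 2) := fun x => Real.sqrt_pos.2 (by positivity)
  have hsq : ∀ x, √(1 + y' x ^ 2) ^ 2 = 1 + y' x ^ 2 := fun x => Real.sq_sqrt (by positivity)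
  obtain ⟨c, hc⟩ := exists_eq_const_of_hasDerivAt_zero hI hIord
    (f := fun x => √(1 + y' x ^ 2) / y x) (fun x hx => by
      have h1 := (((hy' x hx).pow 2).const_add 1).sqrt (by simp; positivity)
      refine HasDerivAt.congr_deriv (h1.div (hy x hx) (hypos x hx).ne') ?_
      have := hypos x hx
      have h2 := hs x
      have h3 := hsq x
      have h4 := h x hx
      simp only [Pi.pow_apply]
      field_simp
      norm_num
      linear_combination 2 * y' x * (h4 - h3))
  obtain ⟨x₀, hx₀⟩ := hIne
  have hc0 : 0 < c := by
    rw [← hc x₀ hx₀]; exact div_pos (hs x₀) (hypos x₀ hx₀)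
  have hcy : ∀ x ∈ I, √(1 + y' x ^ 2) = c * y x := fun x hx => by
    rw [← hc x hx]; field_simp [(hypos x hx).ne']
  obtain ⟨m, hm⟩ := exists_eq_const_of_hasDerivAt_zero hI hIord
    (f := fun x => Real.arsinh (y' x) - c * x) (fun x hx => by
      refine HasDerivAt.congr_deriv ((hy' x hx).arsinh.sub ((hasDerivAt_id x).const_mul c)) ?_
      have h2 := hs x
      have h3 := hsq x
      have h4 := h x hx
      have h5 := hcy x hx
      have := hypos x hx
      rw [smul_eq_mul, mul_one, sub_eq_zero, inv_mul_eq_iff_eq_mul₀ h2.ne']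
      apply mul_right_cancel₀ this.ne'
      linear_combination h4 - h3 + √(1 + y' x ^ 2) * h5)
  refine ⟨c, m, hc0, fun x hx => ?_⟩
  have e : c * x + m = Real.arsinh (y' x) := by rw [← hm x hx]; ring
  rw [e, Real.cosh_arsinh, Real.sinh_arsinh, hcy x hx]
  exact ⟨by field_simp, rfl⟩

theorem exists_eq_sech_add_tanh {I : Set ℝ} (hI : IsOpen I) (hIord : I.OrdConnected)
    {c m : ℝ} (hc : c ≠ 0) {f f' f'' : ℝ → ℝ} (hf : ∀ x ∈ I, HasDerivAt f (f' x) x)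
    (hf' : ∀ x ∈ I, HasDerivAt f' (f'' x) x)
    (h : ∀ x ∈ I, f'' x + c * Real.tanh (c * x + m) * f' x
      + c ^ 2 / Real.cosh (c * x + m) ^ 2 * f x = 0) :
    ∃ d₁ d₂ : ℝ, ∀ x ∈ I,
      f x = d₁ * (Real.cosh (c * x + m))⁻¹ + d₂ * Real.tanh (c * x + m) := by
  obtain ⟨k, hk⟩ := exists_eq_const_of_hasDerivAt_zero hI hIord
    (f := fun x => f' x + c * Real.tanh (c * x + m) * f x) (fun x hx => by
      refine HasDerivAt.congr_deriv ((hf' x hx).add (((hasDerivAt_tanh_affine c m x).const_mul c).mul (hf x hx))) ?_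
      linear_combination h x hx)
  obtain ⟨d, hd⟩ := exists_eq_const_of_hasDerivAt_zero hI hIord
    (f := fun x => Real.cosh (c * x + m) * f x - k / c * Real.sinh (c * x + m)) (fun x hx => by
      refine HasDerivAt.congr_deriv (((hasDerivAt_cosh_affine c m x).mul (hf x hx)).sub
        ((hasDerivAt_sinh_affine c m x).const_mul (k / c))) ?_
      have hC := (Real.cosh_pos (c * x + m)).ne'
      rw [← hk x hx, Real.tanh_eq_sinh_div_cosh]
      field_simp
      ring)
  refine ⟨d, k / c, fun x hx => ?_⟩
  have hC := (Real.cosh_pos (c * x + m)).ne'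
  rw [← hd x hx, Real.tanh_eq_sinh_div_cosh]
  field_simp
  ring

theorem hasDerivAt_catenary_dual_z (v c m d₁ d₂ x : ℝ) :
    HasDerivAt (fun t => -v * t + d₁ * (Real.cosh (c * t + m))⁻¹ + d₂ * Real.tanh (c * t + m))
      (-v - c * d₁ * (Real.tanh (c * x + m) * (Real.cosh (c * x + m))⁻¹)
        + c * d₂ * (Real.cosh (c * x + m))⁻¹ ^ 2) x := by
  refine HasDerivAt.congr_deriv ((((hasDerivAt_id x).const_mul (-v)).add ((hasDerivAt_sech_affine c m x).const_mul d₁)).add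
    ((hasDerivAt_tanh_affine c m x).const_mul d₂)) ?_
  have hC := (Real.cosh_pos (c * x + m)).ne'
  rw [Real.tanh_eq_sinh_div_cosh]
  field_simp
  ring

theorem hasDerivAt_catenary_dual_w {c : ℝ} (hc : c ≠ 0) (v m d₁ d₂ x : ℝ) :
    HasDerivAt (fun t => (v / c) * Real.cosh (c * t + m) + c * d₁ * t - d₁ * Real.tanh (c * t + m)
        + d₂ * (Real.cosh (c * t + m))⁻¹)
      (-(Real.sinh (c * x + m) *
        (-v - c * d₁ * (Real.tanh (c * x + m) * (Real.cosh (c * x + m))⁻¹)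
          + c * d₂ * (Real.cosh (c * x + m))⁻¹ ^ 2))) x := by
  refine HasDerivAt.congr_deriv (((((hasDerivAt_cosh_affine c m x).const_mul (v / c)).add
    ((hasDerivAt_id x).const_mul (c * d₁))).sub ((hasDerivAt_tanh_affine c m x).const_mul d₁)).add
    ((hasDerivAt_sech_affine c m x).const_mul d₂)) ?_
  have hC := (Real.cosh_pos (c * x + m)).ne'
  have hs := Real.cosh_sq_sub_sinh_sq (c * x + m)
  rw [Real.tanh_eq_sinh_div_cosh]
  field_simp
  linear_combination d₁ * c * hs

theorem ContDiffOn.hasDerivAt_deriv_and_deriv_deriv {I : Set ℝ} (hI : IsOpen I) {f : ℝ → ℝ}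
    (hf : ContDiffOn ℝ (⊤ : ℕ∞) f I) :
    (∀ x ∈ I, HasDerivAt f (deriv f x) x) ∧
      ∀ x ∈ I, HasDerivAt (deriv f) (deriv (deriv f) x) x := by
  have hf' : ContDiffOn ℝ 1 (deriv f) I :=
    hf.deriv_of_isOpen hI (by norm_cast)
  exact ⟨fun x hx => ((hf.differentiableOn (by simp)).differentiableAt (hI.mem_nhds hx)).hasDerivAt,
    fun x hx => ((hf'.differentiableOn (by simp)).differentiableAt (hI.mem_nhds hx)).hasDerivAt⟩

/-- classification of catenaries (α = 1) in the dual plane in component form. -/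
theorem statement_2 (v : ℝ) (I : Set ℝ) (hIopen : IsOpen I) (hIne : I.Nonempty)
    (hIord : I.OrdConnected) (y w z : ℝ → ℝ)
    (hy : ContDiffOn ℝ (⊤ : ℕ∞) y I) (hw : ContDiffOn ℝ (⊤ : ℕ∞) w I) (hz : ContDiffOn ℝ (⊤ : ℕ∞) z I)
    (hypos : ∀ x ∈ I, 0 < y x) :
    ((∀ x ∈ I, deriv (deriv y) x * y x = 1 + (deriv y x) ^ 2) ∧
     (∀ x ∈ I, deriv (deriv z) x + (deriv y x / y x) * (deriv z x + v)
        + (z x + v * x) / (y x) ^ 2 = 0) ∧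
     (∀ x ∈ I, deriv w x + deriv y x * deriv z x = 0)) ↔
    (∃ c m d₁ d₂ d₃ : ℝ, 0 < c ∧ ∀ x ∈ I,
      y x = (1 / c) * Real.cosh (c * x + m) ∧
      z x = -v * x + d₁ * (Real.cosh (c * x + m))⁻¹ + d₂ * Real.tanh (c * x + m) ∧
      w x = (v / c) * Real.cosh (c * x + m) + c * d₁ * x - d₁ * Real.tanh (c * x + m)
        + d₂ * (Real.cosh (c * x + m))⁻¹ + d₃) := by
  obtain ⟨hy1, hy2⟩ := hy.hasDerivAt_deriv_and_deriv_deriv hIopen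
  obtain ⟨hz1, hz2⟩ := hz.hasDerivAt_deriv_and_deriv_deriv hIopen
  obtain ⟨hw1, -⟩ := hw.hasDerivAt_deriv_and_deriv_deriv hIopen
  constructor
  · rintro ⟨hcat, hdual, horth⟩
    obtain ⟨c, m, hc, hyc⟩ := exists_eq_cosh_of_catenary hIopen hIne hIord hy1 hy2 hypos hcat
    obtain ⟨d₁, d₂, hd⟩ := exists_eq_sech_add_tanh hIopen hIord (m := m) hc.ne'
      (f := fun x => z x + v * x) (f' := fun x => deriv z x + v) (f'' := deriv (deriv z))
      (fun x hx => ((hz1 x hx).add ((hasDerivAt_id x).const_mul v)).congr_deriv (by simp))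
      (fun x hx => (hz2 x hx).add_const v)
      (fun x hx => by
        have hC := (Real.cosh_pos (c * x + m)).ne'
        rw [← hdual x hx, (hyc x hx).1, (hyc x hx).2, Real.tanh_eq_sinh_div_cosh]
        field_simp)
    have hzc : ∀ x ∈ I, z x =
        -v * x + d₁ * (Real.cosh (c * x + m))⁻¹ + d₂ * Real.tanh (c * x + m) :=
      fun x hx => by linear_combination hd x hx
    obtain ⟨d₃, hd₃⟩ := exists_eq_const_of_hasDerivAt_zero hIopen hIord
      (f := fun t => w t - ((v / c) * Real.cosh (c * t + m) + c * d₁ * t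
        - d₁ * Real.tanh (c * t + m) + d₂ * (Real.cosh (c * t + m))⁻¹)) (fun x hx => by
        refine HasDerivAt.congr_deriv ((hw1 x hx).sub (hasDerivAt_catenary_dual_w hc.ne' v m d₁ d₂ x)) ?_
        have hz' := ((hasDerivAt_catenary_dual_z v c m d₁ d₂ x).congr_of_eventuallyEq
          (Filter.eventuallyEq_of_mem (hIopen.mem_nhds hx) hzc)).deriv
        rw [← hz', ← (hyc x hx).2, sub_neg_eq_add, horth x hx])
    exact ⟨c, m, d₁, d₂, d₃, hc, fun x hx =>
      ⟨(hyc x hx).1, hzc x hx, by linear_combination hd₃ x hx⟩⟩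
  · rintro ⟨c, m, d₁, d₂, d₃, hc, H⟩
    have hy' : ∀ x ∈ I, deriv y x = Real.sinh (c * x + m) := fun x hx => by
      rw [(((hasDerivAt_cosh_affine c m x).const_mul (1 / c)).congr_of_eventuallyEq
        (Filter.eventuallyEq_of_mem (hIopen.mem_nhds hx) fun t ht => (H t ht).1)).deriv]
      field_simp
    have hy'' : ∀ x ∈ I, deriv (deriv y) x = c * Real.cosh (c * x + m) := fun x hx =>
      ((hasDerivAt_sinh_affine c m x).congr_of_eventuallyEq
        (Filter.eventuallyEq_of_mem (hIopen.mem_nhds hx) hy')).deriv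
    have hz' : ∀ x ∈ I, deriv z x =
        -v - c * d₁ * (Real.tanh (c * x + m) * (Real.cosh (c * x + m))⁻¹)
          + c * d₂ * (Real.cosh (c * x + m))⁻¹ ^ 2 := fun x hx =>
      ((hasDerivAt_catenary_dual_z v c m d₁ d₂ x).congr_of_eventuallyEq
        (Filter.eventuallyEq_of_mem (hIopen.mem_nhds hx) fun t ht => (H t ht).2.1)).deriv
    have hw' : ∀ x ∈ I, deriv w x = -(Real.sinh (c * x + m) *
        (-v - c * d₁ * (Real.tanh (c * x + m) * (Real.cosh (c * x + m))⁻¹)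
          + c * d₂ * (Real.cosh (c * x + m))⁻¹ ^ 2)) := fun x hx =>
      (((hasDerivAt_catenary_dual_w hc.ne' v m d₁ d₂ x).add_const d₃).congr_of_eventuallyEq
        (Filter.eventuallyEq_of_mem (hIopen.mem_nhds hx) fun t ht => (H t ht).2.2)).deriv
    refine ⟨fun x hx => ?_, fun x hx => ?_, fun x hx => ?_⟩
    · rw [hy'' x hx, hy' x hx, (H x hx).1]
      field_simp
      linear_combination Real.cosh_sq_sub_sinh_sq (c * x + m)
    · have hz'' := ((((((hasDerivAt_tanh_affine c m x).mul
        (hasDerivAt_sech_affine c m x)).const_mul (c * d₁)).const_sub (-v)).add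
        (((hasDerivAt_sech_affine c m x).pow 2).const_mul (c * d₂))).congr_of_eventuallyEq
        (Filter.eventuallyEq_of_mem (hIopen.mem_nhds hx) hz')).deriv
      have hC := (Real.cosh_pos (c * x + m)).ne'
      rw [hz'', show 2 - 1 = 1 from rfl, pow_one, hz' x hx, hy' x hx, (H x hx).1, (H x hx).2.1, Real.tanh_eq_sinh_div_cosh]
      field_simp
      ring
    · rw [hw' x hx, hy' x hx, hz' x hx]
      ring
end

section
/- Let I ⊆ ℝ be a nonempty open interval, v ∈ ℝ, and let y, w, z : I → ℝ be smooth with y(x) > 0 on I. Then the three conditions (i) y''(x)·y(x) = −(1 + y'(x)²), (ii) z''(x) − (y'(x)/y(x))·(z'(x) + v) − (z(x) + v·x)/y(x)² = 0, and (iii) w'(x) + y'(x)·z'(x) = 0 hold for all x ∈ I if and only if there exist constants R > 0 and m, d₁, d₂, d₃ ∈ ℝ with I ⊆ (m−R, m+R) such that for all x ∈ I, writing Y(x) = √(R² − (x−m)²): y(x) = Y(x), z(x) = −v·x + d₁·(x−m) + d₂·(Y(x) + (x−m)·arcsin((x−m)/R)), and w(x) = (v − d₁)·Y(x) + d₂·(x−m)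 − d₂·Y(x)·arcsin((x−m)/R) + d₃. -/
/-- A function with vanishing derivative on an open order-connected set of reals is constant. -/
theorem exists_const_of_hasDerivAt_zero {I : Set ℝ} (hIopen : IsOpen I) (hIord : I.OrdConnected)
    {f : ℝ → ℝ} (hf : ∀ x ∈ I, HasDerivAt f 0 x) : ∃ c, ∀ x ∈ I, f x = c :=
  hIopen.exists_is_const_of_deriv_eq_zero hIord.isPreconnected
    (fun x hx => (hf x hx).differentiableAt.differentiableWithinAt) fun x hx => (hf x hx).deriv

theorem HasDerivAt.congr_of_eqOn_isOpen {I : Set ℝ} (hIopen : IsOpen I) {f g : ℝ → ℝ} {g' x : ℝ}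
    (hx : x ∈ I) (hg : HasDerivAt g g' x) (h : ∀ t ∈ I, f t = g t) : HasDerivAt f g' x :=
  hg.congr_of_eventuallyEq (Filter.eventually_of_mem (hIopen.mem_nhds hx) h)

theorem ContDiffOn.hasDerivAt_deriv_of_isOpen {I : Set ℝ} (hIopen : IsOpen I) {f : ℝ → ℝ}
    (hf : ContDiffOn ℝ (⊤ : ℕ∞) f I) {x : ℝ} (hx : x ∈ I) : HasDerivAt f (deriv f x) x :=
  ((hf.contDiffAt (hIopen.mem_nhds hx)).differentiableAt (by simp)).hasDerivAt

theorem ContDiffOn.hasDerivAt_deriv_deriv_of_isOpen {I : Set ℝ} (hIopen : IsOpen I) {f : ℝ → ℝ}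
    (hf : ContDiffOn ℝ (⊤ : ℕ∞) f I) {x : ℝ} (hx : x ∈ I) :
    HasDerivAt (deriv f) (deriv (deriv f) x) x :=
  ContDiffOn.hasDerivAt_deriv_of_isOpen hIopen
    (hf.deriv_of_isOpen hIopen (m := ((⊤ : ℕ∞) : WithTop ℕ∞)) (by simp)) hx

theorem sq_sub_sq_pos_of_mem_Ioo {R m x : ℝ} (hx : x ∈ Set.Ioo (m - R) (m + R)) :
    0 < R ^ 2 - (x - m) ^ 2 := by
  nlinarith [hx.1, hx.2]

theorem hasDerivAt_sqrt_sq_sub_sq {R m x : ℝ} (hx : 0 < R ^ 2 - (x - m) ^ 2) :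
    HasDerivAt (fun t => √(R ^ 2 - (t - m) ^ 2)) (-(x - m) / √(R ^ 2 - (x - m) ^ 2)) x := by
  have h := ((((hasDerivAt_id x).sub_const m).pow 2).const_sub (R ^ 2)).sqrt hx.ne'
  refine h.congr_deriv ?_
  have : √(R ^ 2 - (x - m) ^ 2) ≠ 0 := (Real.sqrt_pos.2 hx).ne'
  simp only [id, Pi.pow_apply]
  field_simp
  norm_num [mul_comm]

theorem hasDerivAt_arcsin_sub_div {R m x : ℝ} (hR : 0 < R) (hx : 0 < R ^ 2 - (x - m) ^ 2) :
    HasDerivAt (fun t => Real.arcsin ((t - m) / R)) (1 / √(R ^ 2 - (x - m) ^ 2)) x := by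
  have hlt : |x - m| < |R| := sq_lt_sq.1 (by linarith)
  rw [abs_of_pos hR, abs_lt] at hlt
  have h1 : (x - m) / R ≠ -1 := by
    rw [Ne, div_eq_iff hR.ne']; intro h; linarith
  have h2 : (x - m) / R ≠ 1 := by
    rw [Ne, div_eq_iff hR.ne']; intro h; linarith
  have h := (Real.hasDerivAt_arcsin h1 h2).comp x (((hasDerivAt_id x).sub_const m).div_const R)
  refine h.congr_deriv ?_
  have e : √(1 - ((x - m) / R) ^ 2) = √(R ^ 2 - (x - m) ^ 2) / R := by
    rw [← Real.sqrt_sq hR.le, ← Real.sqrt_div' _ (sq_nonneg R), Real.sqrt_sq hR.le]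
    congr 1
    field_simp
  simp only [e]
  have := (Real.sqrt_pos.2 hx).ne'
  field_simp

/-- A positive solution of `y'' y = -(1 + y' ^ 2)` is an arc of a circle centred on the axis. -/
theorem exists_eq_sqrt_of_deriv_deriv_mul {I : Set ℝ} (hIopen : IsOpen I) (hIne : I.Nonempty)
    (hIord : I.OrdConnected) {y y' y'' : ℝ → ℝ} (hy : ∀ x ∈ I, HasDerivAt y (y' x) x)
    (hy' : ∀ x ∈ I, HasDerivAt y' (y'' x) x) (hypos : ∀ x ∈ I, 0 < y x)
    (h : ∀ x ∈ I, y'' x * y x = -(1 + y' x ^ 2)) :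
    ∃ R m : ℝ, 0 < R ∧ I ⊆ Set.Ioo (m - R) (m + R) ∧
      ∀ x ∈ I, y x = √(R ^ 2 - (x - m) ^ 2) := by
  obtain ⟨m, hm⟩ := exists_const_of_hasDerivAt_zero hIopen hIord
    (f := fun x => y x * y' x + x) fun x hx =>
      (((hy x hx).mul (hy' x hx)).add (hasDerivAt_id x)).congr_deriv (by linarith [h x hx])
  obtain ⟨K, hK⟩ := exists_const_of_hasDerivAt_zero hIopen hIord
    (f := fun x => y x ^ 2 + (x - m) ^ 2) fun x hx =>
      (((hy x hx).pow 2).add (((hasDerivAt_id x).sub_const m).pow 2)).congr_deriv (by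
        have := hm x hx
        simp only [id] at *
        push_cast
        linear_combination 2 * this)
  have hKpos : 0 < K := by
    obtain ⟨x, hx⟩ := hIne
    rw [← hK x hx]
    have := hypos x hx
    positivity
  have hsq : √K ^ 2 = K := Real.sq_sqrt hKpos.le
  refine ⟨√K, m, Real.sqrt_pos.2 hKpos, fun x hx => ?_, fun x hx => ?_⟩
  · have h1 : (x - m) ^ 2 < √K ^ 2 := by
      have := pow_pos (hypos x hx) 2
      have := hK x hx
      linarith
    have := abs_lt.1 (abs_lt_of_sq_lt_sq h1 (Real.sqrt_nonneg K))
    constructor <;> linarith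
  · rw [hsq, ← hK x hx, add_sub_cancel_right, Real.sqrt_sq (hypos x hx).le]

/-- Solutions of the linear equation `Y² u'' + (x - m) u' - u = 0`, `Y² = R² - (x - m)²`. -/
theorem exists_eq_of_dual_catenary {I : Set ℝ} (hIopen : IsOpen I) (hIord : I.OrdConnected)
    {R m : ℝ} (hR : 0 < R) (hI : I ⊆ Set.Ioo (m - R) (m + R)) {u u' u'' : ℝ → ℝ}
    (hu : ∀ x ∈ I, HasDerivAt u (u' x) x) (hu' : ∀ x ∈ I, HasDerivAt u' (u'' x) x)
    (h : ∀ x ∈ I, √(R ^ 2 - (x - m) ^ 2) ^ 2 * u'' x + (x - m) * u' x - u x = 0) :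
    ∃ d₁ d₂ : ℝ, ∀ x ∈ I, u' x = d₁ + d₂ * Real.arcsin ((x - m) / R) ∧
      u x = d₁ * (x - m) +
        d₂ * (√(R ^ 2 - (x - m) ^ 2) + (x - m) * Real.arcsin ((x - m) / R)) := by
  have hpos : ∀ x ∈ I, 0 < R ^ 2 - (x - m) ^ 2 := fun x hx => sq_sub_sq_pos_of_mem_Ioo (hI hx)
  obtain ⟨d₂, hd₂⟩ := exists_const_of_hasDerivAt_zero hIopen hIord
    (f := fun x => (u x - (x - m) * u' x) / √(R ^ 2 - (x - m) ^ 2)) fun x hx =>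
      (((hu x hx).sub (((hasDerivAt_id x).sub_const m).mul (hu' x hx))).div
        (hasDerivAt_sqrt_sq_sub_sq (hpos x hx)) (Real.sqrt_pos.2 (hpos x hx)).ne').congr_deriv (by
          have := (Real.sqrt_pos.2 (hpos x hx)).ne'
          have := h x hx
          simp only [id, Pi.mul_apply, Pi.sub_apply] at *
          field_simp
          linear_combination (-(x - m)) * this)
  have hd : ∀ x ∈ I, u x - (x - m) * u' x = d₂ * √(R ^ 2 - (x - m) ^ 2) := fun x hx =>
    (div_eq_iff (Real.sqrt_pos.2 (hpos x hx)).ne').1 (hd₂ x hx)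
  obtain ⟨d₁, hd₁⟩ := exists_const_of_hasDerivAt_zero hIopen hIord
    (f := fun x => u' x - d₂ * Real.arcsin ((x - m) / R)) fun x hx =>
      ((hu' x hx).sub ((hasDerivAt_arcsin_sub_div hR (hpos x hx)).const_mul d₂)).congr_deriv (by
        have hY := (Real.sqrt_pos.2 (hpos x hx)).ne'
        have h1 := h x hx
        have h2 := hd x hx
        rw [mul_one_div, sub_eq_zero, eq_div_iff hY]
        apply mul_left_cancel₀ hY
        linear_combination h1 + h2)
  refine ⟨d₁, d₂, fun x hx => ?_⟩
  have h1 := hd₁ x hx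
  have h2 := hd x hx
  exact ⟨by linear_combination h1, by linear_combination h2 + (x - m) * h1⟩

theorem hasDerivAt_sqrt_add_mul_arcsin {R m x : ℝ} (hR : 0 < R) (hx : 0 < R ^ 2 - (x - m) ^ 2) :
    HasDerivAt (fun t => √(R ^ 2 - (t - m) ^ 2) + (t - m) * Real.arcsin ((t - m) / R))
      (Real.arcsin ((x - m) / R)) x :=
  ((hasDerivAt_sqrt_sq_sub_sq hx).add
    (((hasDerivAt_id x).sub_const m).mul (hasDerivAt_arcsin_sub_div hR hx))).congr_deriv (by
      simp only [id]
      ring)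

theorem hasDerivAt_dual_catenary_height {R m x : ℝ} (v d₁ d₂ d₃ : ℝ) (hR : 0 < R)
    (hx : 0 < R ^ 2 - (x - m) ^ 2) :
    HasDerivAt (fun t => (v - d₁) * √(R ^ 2 - (t - m) ^ 2) + d₂ * (t - m)
        - d₂ * √(R ^ 2 - (t - m) ^ 2) * Real.arcsin ((t - m) / R) + d₃)
      ((x - m) / √(R ^ 2 - (x - m) ^ 2) * (-v + (d₁ + d₂ * Real.arcsin ((x - m) / R)))) x := by
  have hY := hasDerivAt_sqrt_sq_sub_sq hx
  have h := (((hY.const_mul (v - d₁)).add (((hasDerivAt_id x).sub_const m).const_mul d₂)).sub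
    ((hY.const_mul d₂).mul (hasDerivAt_arcsin_sub_div hR hx))).add_const d₃
  refine h.congr_deriv ?_
  have := (Real.sqrt_pos.2 hx).ne'
  field_simp
  ring


/-- classification of (−1)-catenaries in the dual plane in component form. -/
theorem statement_3 (v : ℝ) (I : Set ℝ) (hIopen : IsOpen I) (hIne : I.Nonempty)
    (hIord : I.OrdConnected) (y w z : ℝ → ℝ)
    (hy : ContDiffOn ℝ (⊤ : ℕ∞) y I) (hw : ContDiffOn ℝ (⊤ : ℕ∞) w I) (hz : ContDiffOn ℝ (⊤ : ℕ∞) z I)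
    (hypos : ∀ x ∈ I, 0 < y x) :
    ((∀ x ∈ I, deriv (deriv y) x * y x = -(1 + (deriv y x) ^ 2)) ∧
     (∀ x ∈ I, deriv (deriv z) x - (deriv y x / y x) * (deriv z x + v)
        - (z x + v * x) / (y x) ^ 2 = 0) ∧
     (∀ x ∈ I, deriv w x + deriv y x * deriv z x = 0)) ↔
    (∃ R m d₁ d₂ d₃ : ℝ, 0 < R ∧ I ⊆ Set.Ioo (m - R) (m + R) ∧ ∀ x ∈ I,
      y x = Real.sqrt (R ^ 2 - (x - m) ^ 2) ∧
      z x = -v * x + d₁ * (x - m)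
        + d₂ * (Real.sqrt (R ^ 2 - (x - m) ^ 2)
            + (x - m) * Real.arcsin ((x - m) / R)) ∧
      w x = (v - d₁) * Real.sqrt (R ^ 2 - (x - m) ^ 2) + d₂ * (x - m)
        - d₂ * Real.sqrt (R ^ 2 - (x - m) ^ 2) * Real.arcsin ((x - m) / R) + d₃) := by
  constructor
  · rintro ⟨h₁, h₂, h₃⟩
    obtain ⟨R, m, hR, hI, hyY⟩ := exists_eq_sqrt_of_deriv_deriv_mul hIopen hIne hIord
      (fun x hx => hy.hasDerivAt_deriv_of_isOpen hIopen hx)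
      (fun x hx => hy.hasDerivAt_deriv_deriv_of_isOpen hIopen hx) hypos h₁
    have hpos : ∀ x ∈ I, 0 < R ^ 2 - (x - m) ^ 2 := fun x hx => sq_sub_sq_pos_of_mem_Ioo (hI hx)
    have hdy : ∀ x ∈ I, deriv y x = -(x - m) / √(R ^ 2 - (x - m) ^ 2) := fun x hx =>
      ((hasDerivAt_sqrt_sq_sub_sq (hpos x hx)).congr_of_eqOn_isOpen hIopen hx hyY).deriv
    obtain ⟨d₁, d₂, hd⟩ := exists_eq_of_dual_catenary hIopen hIord hR hI
      (u := fun x => z x + v * x) (u' := fun x => deriv z x + v) (u'' := deriv (deriv z))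
      (fun x hx => ((hz.hasDerivAt_deriv_of_isOpen hIopen hx).add
        ((hasDerivAt_id x).const_mul v)).congr_deriv (by ring))
      (fun x hx => (hz.hasDerivAt_deriv_deriv_of_isOpen hIopen hx).add_const v)
      (fun x hx => by
        have h := h₂ x hx
        rw [hdy x hx, hyY x hx] at h
        have := (Real.sqrt_pos.2 (hpos x hx)).ne'
        field_simp at h
        linear_combination h)
    obtain ⟨d₃, hd₃⟩ := exists_const_of_hasDerivAt_zero hIopen hIord
      fun x hx => ((hw.hasDerivAt_deriv_of_isOpen hIopen hx).sub
        (hasDerivAt_dual_catenary_height v d₁ d₂ 0 hR (hpos x hx))).congr_deriv (by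
          have h := h₃ x hx
          rw [hdy x hx] at h
          linear_combination h + (x - m) / √(R ^ 2 - (x - m) ^ 2) * (hd x hx).1)
    refine ⟨R, m, d₁, d₂, d₃, hR, hI, fun x hx => ⟨hyY x hx, ?_, ?_⟩⟩
    · linear_combination (hd x hx).2
    · have h := hd₃ x hx
      simp only [Pi.sub_apply] at h
      linear_combination h
  · rintro ⟨R, m, d₁, d₂, d₃, hR, hI, h⟩
    have hpos : ∀ x ∈ I, 0 < R ^ 2 - (x - m) ^ 2 := fun x hx => sq_sub_sq_pos_of_mem_Ioo (hI hx)
    have hdy : ∀ x ∈ I, deriv y x = -(x - m) / √(R ^ 2 - (x - m) ^ 2) := fun x hx =>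
      ((hasDerivAt_sqrt_sq_sub_sq (hpos x hx)).congr_of_eqOn_isOpen hIopen hx
        fun t ht => (h t ht).1).deriv
    have hdz : ∀ x ∈ I, deriv z x = -v + (d₁ + d₂ * Real.arcsin ((x - m) / R)) := fun x hx =>
      (((((hasDerivAt_id x).const_mul (-v)).add
        (((hasDerivAt_id x).sub_const m).const_mul d₁)).add
        ((hasDerivAt_sqrt_add_mul_arcsin hR (hpos x hx)).const_mul d₂)).congr_of_eqOn_isOpen
          hIopen hx fun t ht => (h t ht).2.1).deriv.trans (by ring)
    have hdw : ∀ x ∈ I, deriv w x = _ := fun x hx =>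
      ((hasDerivAt_dual_catenary_height v d₁ d₂ d₃ hR (hpos x hx)).congr_of_eqOn_isOpen
        hIopen hx fun t ht => (h t ht).2.2).deriv
    refine ⟨fun x hx => ?_, fun x hx => ?_, fun x hx => ?_⟩
    · have hY := (Real.sqrt_pos.2 (hpos x hx)).ne'
      rw [(((((hasDerivAt_id x).sub_const m).neg).div (hasDerivAt_sqrt_sq_sub_sq (hpos x hx))
        hY).congr_of_eqOn_isOpen hIopen hx hdy).deriv, hdy x hx, (h x hx).1]
      simp only [id, Pi.neg_apply]
      field_simp
      ring
    · have hY := (Real.sqrt_pos.2 (hpos x hx)).ne'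
      rw [(((((hasDerivAt_arcsin_sub_div hR (hpos x hx)).const_mul d₂).const_add
        d₁).const_add (-v)).congr_of_eqOn_isOpen hIopen hx hdz).deriv, hdy x hx, hdz x hx,
        (h x hx).1, (h x hx).2.1]
      field_simp
      ring
    · rw [hdw x hx, hdy x hx, hdz x hx]
      ring
end

section
/- Let I, J ⊆ ℝ be open intervals, let y, w, z : I → ℝ be smooth with w'(x) + y'(x)·z'(x) = 0 on I, and set ν(x) = √(1 + y'(x)²). Let f : J → I be smooth with f'(s) = 1/ν(f(s)) for all s ∈ J (an arc-length reparametrization of the graph curve ψ(x) = (x, y(x))). Define Φ : J → ℝ² by Φ(s) = (w(f(s)), z(f(s))), and let N(x) = (−y'(x), 1)/ν(x) ∈ ℝ² be the unit normal of ψ. Then for all s ∈ J, the Euclidean inner product satisfies ⟨Φ''(s), N(f(s))⟩ = z''(f(s)) / ν(f(s)). -/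
open scoped RealInnerProductSpace

theorem HasDerivAt.euclideanPlane {u v : ℝ → ℝ} {u' v' s : ℝ}
    (hu : HasDerivAt u u' s) (hv : HasDerivAt v v' s) :
    HasDerivAt (fun t => !₂[u t, v t]) !₂[u', v'] s := by
  have h : HasDerivAt (fun t => ![u t, v t]) ![u', v'] s :=
    hasDerivAt_pi.2 fun i => by fin_cases i <;> simpa
  exact (PiLp.continuousLinearEquiv 2 ℝ fun _ : Fin 2 => ℝ).symm.hasFDerivAt.comp_hasDerivAt s h

theorem ContDiffOn.hasDerivAt_of_isOpen {g : ℝ → ℝ} {U : Set ℝ}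
    (hg : ContDiffOn ℝ (⊤ : ℕ∞) g U) (hU : IsOpen U) {x : ℝ} (hx : x ∈ U) :
    HasDerivAt g (deriv g x) x :=
  ((hg.differentiableOn (by simp)).differentiableAt (hU.mem_nhds hx)).hasDerivAt

/-- for an admissible dual-plane curve with components `y, w, z` and arc-length
reparametrization `f` of the graph of `y`, the dual part of the curvature is
`⟨Φ'', N∘f⟩ = z''∘f / ν∘f`, where `Φ = (w∘f, z∘f)` and `N` is the unit normal. -/
theorem statement_5 (I J : Set ℝ) (hIopen : IsOpen I) (hJopen : IsOpen J)
    (hIord : I.OrdConnected) (hJord : J.OrdConnected)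
    (y w z : ℝ → ℝ)
    (hy : ContDiffOn ℝ (⊤ : ℕ∞) y I) (hw : ContDiffOn ℝ (⊤ : ℕ∞) w I) (hz : ContDiffOn ℝ (⊤ : ℕ∞) z I)
    (horth : ∀ x ∈ I, deriv w x + deriv y x * deriv z x = 0)
    (ν : ℝ → ℝ) (hν : ∀ x, ν x = Real.sqrt (1 + (deriv y x) ^ 2))
    (f : ℝ → ℝ) (hf : ContDiffOn ℝ (⊤ : ℕ∞) f J) (hmaps : Set.MapsTo f J I)
    (hf' : ∀ s ∈ J, deriv f s = 1 / ν (f s))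
    (Φ : ℝ → EuclideanSpace ℝ (Fin 2))
    (hΦ : ∀ s, Φ s = (WithLp.equiv 2 (Fin 2 → ℝ)).symm ![w (f s), z (f s)])
    (N : ℝ → EuclideanSpace ℝ (Fin 2))
    (hN : ∀ x, N x = (ν x)⁻¹ • (WithLp.equiv 2 (Fin 2 → ℝ)).symm ![-(deriv y x), 1]) :
    ∀ s ∈ J, ⟪deriv (deriv Φ) s, N (f s)⟫ = deriv (deriv z) (f s) / ν (f s) := by
  intro s hs
  have hdf := fun t ht => hf.hasDerivAt_of_isOpen hJopen (x := t) ht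
  have hdw := fun t ht => hw.hasDerivAt_of_isOpen hIopen (x := t) ht
  have hdz := fun t ht => hz.hasDerivAt_of_isOpen hIopen (x := t) ht
  have hdf₂ := (hf.deriv_of_isOpen (m := (⊤ : ℕ∞)) hJopen (by simp)).hasDerivAt_of_isOpen hJopen hs
  have hdy₂ := (hy.deriv_of_isOpen (m := (⊤ : ℕ∞)) hIopen (by simp)).hasDerivAt_of_isOpen hIopen
    (hmaps hs)
  have hdw₂ := (hw.deriv_of_isOpen (m := (⊤ : ℕ∞)) hIopen (by simp)).hasDerivAt_of_isOpen hIopen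
    (hmaps hs)
  have hdz₂ := (hz.deriv_of_isOpen (m := (⊤ : ℕ∞)) hIopen (by simp)).hasDerivAt_of_isOpen hIopen
    (hmaps hs)
  have hΦ_eq : Φ = fun t => !₂[w (f t), z (f t)] := funext hΦ
  have hΦ₁ : deriv Φ =ᶠ[nhds s]
      fun t => !₂[deriv w (f t) * deriv f t, deriv z (f t) * deriv f t] := by
    filter_upwards [hJopen.mem_nhds hs] with t ht
    rw [hΦ_eq]
    exact (((hdw _ (hmaps ht)).comp t (hdf t ht)).euclideanPlane
      ((hdz _ (hmaps ht)).comp t (hdf t ht))).deriv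
  have hΦ₂ := hΦ₁.deriv_eq.trans (((hdw₂.comp s (hdf s hs)).mul hdf₂).euclideanPlane
    ((hdz₂.comp s (hdf s hs)).mul hdf₂)).deriv
  have hν_pos : 0 < ν (f s) := by rw [hν]; positivity
  have hν_sq : ∀ x, ν x ^ 2 = 1 + deriv y x ^ 2 := fun x => by
    rw [hν, Real.sq_sqrt (by positivity)]
  have horth' : deriv (deriv w) (f s) + (deriv (deriv y) (f s) * deriv z (f s) +
      deriv y (f s) * deriv (deriv z) (f s)) = 0 := by
    refine (hdw₂.add (hdy₂.mul hdz₂)).unique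
      ((hasDerivAt_const (f s) (0 : ℝ)).congr_of_eventuallyEq ?_)
    filter_upwards [hIopen.mem_nhds (hmaps hs)] with x hx using horth x hx
  have hspeed : ∀ t ∈ J, deriv f t ^ 2 * (1 + deriv y (f t) ^ 2) = 1 := fun t ht => by
    have : ν (f t) ≠ 0 := by rw [hν]; positivity
    rw [hf' t ht, ← hν_sq]
    field_simp
  have hspeed' := ((hdf₂.pow 2).mul (((hdy₂.comp s (hdf s hs)).pow 2).const_add 1)).unique
    ((hasDerivAt_const s (1 : ℝ)).congr_of_eventuallyEq
      (by filter_upwards [hJopen.mem_nhds hs] with t ht using hspeed t ht))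
  have hf_ne : deriv f s ≠ 0 := by rw [hf' s hs]; positivity
  have haccel : deriv (deriv f) s * (1 + deriv y (f s) ^ 2) +
      deriv f s ^ 2 * deriv y (f s) * deriv (deriv y) (f s) = 0 := by
    refine mul_left_cancel₀ (mul_ne_zero two_ne_zero hf_ne) ?_
    simp only [Function.comp_apply, Pi.pow_apply] at hspeed'
    norm_num at hspeed'
    linear_combination hspeed'
  have hinner : ⟪deriv (deriv Φ) s, N (f s)⟫ = (ν (f s))⁻¹ *
      ((deriv (deriv w) (f s) * deriv f s * deriv f s + deriv w (f s) * deriv (deriv f) s) *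
        -deriv y (f s) +
      (deriv (deriv z) (f s) * deriv f s * deriv f s + deriv z (f s) * deriv (deriv f) s)) := by
    rw [hΦ₂, hN, inner_smul_right]
    congr 1
    simp [PiLp.inner_apply]
    ring
  rw [hinner, div_eq_inv_mul]
  congr 1
  linear_combination (-deriv y (f s) * deriv f s ^ 2) * horth'
    - deriv y (f s) * deriv (deriv f) s * horth (f s) (hmaps hs)
    + deriv z (f s) * haccel + deriv (deriv z) (f s) * hspeed s hs
end

section
/- Let α, v ∈ ℝ, let I ⊆ ℝ be a nonempty open interval, and let y, w, z : I → ℝ be smooth with y(x) > 0 and w'(x) + y'(x)·z'(x) = 0 on I. Write ν(x) = √(1 + y'(x)²). In the dual numbers DualNumber ℝ (where ε² = 0), define for x ∈ I: K(x) = y''(x)/ν(x)³ + ε·(z''(x)/ν(x)) (the dual curvature), P(x) = y(x) + ε·(v·x + z(x)) (the dual inner product ⟨γ(x), 𝐮⟩), and Q(x) = 1/ν(x) + ε·(−y'(x)·(v + z'(x))/ν(x)) (the dual inner product ⟨N_γ(x), 𝐮⟩). Then the following are equivalent: (a) y''(x)·y(x) = α·(1 + y'(x)²) and z''(x) + α·(y'(x)/y(x))·(z'(x)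 + v) + α·(z(x) + v·x)/y(x)² = 0 for all x ∈ I; (b) K(x)·P(x) = α·Q(x) in DualNumber ℝ for all x ∈ I. (Since y > 0, P(x) is invertible, so (b) is equivalent to K = α·Q/P, i.e., κ_γ = α⟨N_γ,𝐮⟩/⟨γ,𝐮⟩.) -/
/-- The equation `(a + ε·b)(c + ε·d) = r(e + ε·f)` in the dual numbers, split into its real and
dual parts. -/
lemma DualNumber.add_eps_mul_mul_eq_algebraMap_mul_iff (a b c d e f r : ℝ) :
    (algebraMap ℝ (DualNumber ℝ) a + DualNumber.eps * algebraMap ℝ (DualNumber ℝ) b)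
        * (algebraMap ℝ (DualNumber ℝ) c + DualNumber.eps * algebraMap ℝ (DualNumber ℝ) d)
      = algebraMap ℝ (DualNumber ℝ) r
        * (algebraMap ℝ (DualNumber ℝ) e + DualNumber.eps * algebraMap ℝ (DualNumber ℝ) f) ↔
    a * c = r * e ∧ a * d + b * c = r * f := by
  rw [TrivSqZeroExt.ext_iff]
  simp [TrivSqZeroExt.algebraMap_eq_inl, mul_comm]

/-- The two scalar equations at a point, with `p = y'`, `s = y''`, `q = z'`, `t = z''` and
`u = v x + z`, are the real and dual parts of the curvature equation. -/
lemma catenary_equations_iff {α v y p s q t u n : ℝ} (hy : 0 < y) (hn : 0 < n)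
    (hn2 : n ^ 2 = 1 + p ^ 2) :
    (s * y = α * (1 + p ^ 2) ∧ t + α * (p / y) * (q + v) + α * u / y ^ 2 = 0) ↔
    (s / n ^ 3 * y = α * (1 / n) ∧ s / n ^ 3 * u + t / n * y = α * (-p * (v + q) / n)) := by
  have hreal : s / n ^ 3 * y = α * (1 / n) ↔ s * y = α * (1 + p ^ 2) := by
    rw [← hn2]
    field_simp
  rw [hreal]
  refine and_congr_right fun h => ?_
  obtain rfl : s = α * n ^ 2 / y := by
    rw [eq_div_iff hy.ne', h, hn2]
  have hfactor : α * n ^ 2 / y / n ^ 3 * u + t / n * y - α * (-p * (v + q) / n)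
      = y / n * (t + α * (p / y) * (q + v) + α * u / y ^ 2) := by
    field_simp
    ring
  rw [← sub_eq_zero (a := α * n ^ 2 / y / n ^ 3 * u + t / n * y), hfactor, mul_eq_zero,
    or_iff_right (div_pos hy hn).ne']

/-- characterization of α-catenaries in the dual plane: with dual curvature
`K = y''/ν³ + ε·z''/ν`, `P = ⟨γ,𝐮⟩ = y + ε(vx+z)` and `Q = ⟨N_γ,𝐮⟩ = 1/ν + ε(−y'(v+z')/ν)`,
the curve is an α-catenary iff `K·P = α·Q` in the dual numbers, i.e. `κ_γ = α⟨N_γ,𝐮⟩/⟨γ,𝐮⟩`. -/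
theorem statement_7 (α v : ℝ) (I : Set ℝ) (hIopen : IsOpen I) (hIne : I.Nonempty)
    (hIord : I.OrdConnected) (y w z : ℝ → ℝ)
    (hy : ContDiffOn ℝ (⊤ : ℕ∞) y I) (hw : ContDiffOn ℝ (⊤ : ℕ∞) w I) (hz : ContDiffOn ℝ (⊤ : ℕ∞) z I)
    (hypos : ∀ x ∈ I, 0 < y x)
    (horth : ∀ x ∈ I, deriv w x + deriv y x * deriv z x = 0)
    (ν : ℝ → ℝ) (hν : ∀ x, ν x = Real.sqrt (1 + (deriv y x) ^ 2))
    (K P Q : ℝ → DualNumber ℝ)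
    (hK : ∀ x, K x = algebraMap ℝ (DualNumber ℝ) (deriv (deriv y) x / (ν x) ^ 3)
        + DualNumber.eps * algebraMap ℝ (DualNumber ℝ) (deriv (deriv z) x / ν x))
    (hP : ∀ x, P x = algebraMap ℝ (DualNumber ℝ) (y x)
        + DualNumber.eps * algebraMap ℝ (DualNumber ℝ) (v * x + z x))
    (hQ : ∀ x, Q x = algebraMap ℝ (DualNumber ℝ) (1 / ν x)
        + DualNumber.eps * algebraMap ℝ (DualNumber ℝ) (-(deriv y x) * (v + deriv z x) / ν x)) :
    ((∀ x ∈ I, deriv (deriv y) x * y x = α * (1 + (deriv y x) ^ 2)) ∧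
     (∀ x ∈ I, deriv (deriv z) x + α * (deriv y x / y x) * (deriv z x + v)
        + α * (z x + v * x) / (y x) ^ 2 = 0)) ↔
    (∀ x ∈ I, K x * P x = algebraMap ℝ (DualNumber ℝ) α * Q x) := by
  rw [← forall₂_and]
  refine forall₂_congr fun x hx => ?_
  have hpos : 0 < 1 + deriv y x ^ 2 := by positivity
  have hνpos : 0 < ν x := hν x ▸ Real.sqrt_pos.mpr hpos
  have hνsq : ν x ^ 2 = 1 + deriv y x ^ 2 := by rw [hν, Real.sq_sqrt hpos.le]
  rw [hK, hP, hQ, DualNumber.add_eps_mul_mul_eq_algebraMap_mul_iff, add_comm (z x)]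
  exact catenary_equations_iff (hypos x hx) hνpos hνsq
end

section
/- Let α ∈ ℝ, a < b, and let y : [a,b] → ℝ be smooth with y(x) > 0 on [a,b]. Then y satisfies y''(x)·y(x) = α·(1 + y'(x)²) for all x ∈ [a,b] if and only if for every smooth η : [a,b] → ℝ with η(a) = η(b) = 0, the function t ↦ ∫_a^b (y(x) + t·η(x))^α · √(1 + (y'(x) + t·η'(x))²) dx has derivative 0 at t = 0 (powers are real powers, well defined since y + t·η > 0 for t near 0). -/
open Set Filter Topology

/-- Differentiation of an interval integral with respect to a parameter, for an integrand whose
derivative in the parameter is jointly continuous. -/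
theorem hasDerivAt_intervalIntegral_of_continuousOn {a b ε t₀ : ℝ} (hab : a ≤ b) (hε : 0 < ε)
    {F F' : ℝ → ℝ → ℝ}
    (hF : ∀ t ∈ Metric.closedBall t₀ ε, ContinuousOn (F t) (Icc a b))
    (hF' : ContinuousOn (fun z : ℝ × ℝ => F' z.1 z.2) (Metric.closedBall t₀ ε ×ˢ Icc a b))
    (hd : ∀ x ∈ Icc a b, ∀ t ∈ Metric.closedBall t₀ ε, HasDerivAt (F · x) (F' t x) t) :
    HasDerivAt (fun t => ∫ x in a..b, F t x) (∫ x in a..b, F' t₀ x) t₀ := by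
  obtain ⟨C, hC⟩ := ((isCompact_closedBall t₀ ε).prod isCompact_Icc).exists_bound_of_continuousOn hF'
  have ht₀ : t₀ ∈ Metric.closedBall t₀ ε := Metric.mem_closedBall_self hε.le
  have hsub : Set.uIoc a b ⊆ Icc a b := by
    rw [Set.uIoc_of_le hab]; exact Ioc_subset_Icc_self
  have hF₀' : ContinuousOn (F' t₀) (Icc a b) :=
    hF'.comp (f := fun x => (t₀, x)) (by fun_prop) fun x hx => ⟨ht₀, hx⟩
  refine (intervalIntegral.hasDerivAt_integral_of_dominated_loc_of_deriv_le (bound := fun _ => C)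
    (Metric.closedBall_mem_nhds t₀ hε) ?_ ?_ ?_ ?_ ?_ ?_).2
  · filter_upwards [Metric.closedBall_mem_nhds t₀ hε] with t ht
    exact ((hF t ht).mono hsub).aestronglyMeasurable measurableSet_uIoc
  · exact (hF t₀ ht₀).intervalIntegrable_of_Icc hab
  · exact (hF₀'.mono hsub).aestronglyMeasurable measurableSet_uIoc
  · exact Eventually.of_forall fun x hx t ht => hC (t, x) ⟨ht, hsub hx⟩
  · exact intervalIntegrable_const
  · exact Eventually.of_forall fun x hx t ht => hd x (hsub hx) t ht

/-- Pointwise derivative of the energy density along a variation. -/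
theorem hasDerivAt_energy_density (α u v p q t : ℝ) (h : 0 < u + t * v) :
    HasDerivAt (fun s : ℝ => (u + s * v) ^ α * Real.sqrt (1 + (p + s * q) ^ 2))
      (α * (u + t * v) ^ (α - 1) * v * Real.sqrt (1 + (p + t * q) ^ 2)
        + (u + t * v) ^ α * ((p + t * q) * q / Real.sqrt (1 + (p + t * q) ^ 2))) t := by
  have hlin (c d : ℝ) : HasDerivAt (fun s : ℝ => c + s * d) d t := by
    simpa using ((hasDerivAt_id t).mul_const d).const_add c
  have hw : (0 : ℝ) < 1 + (p + t * q) ^ 2 := by positivity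
  have h1 := (hlin u v).rpow_const (p := α) (Or.inl h.ne')
  have h2 := (((hlin p q).pow 2).const_add 1).sqrt hw.ne'
  refine (h1.mul h2).congr_deriv ?_
  have := (Real.sqrt_pos.2 hw).ne'
  simp only [Pi.pow_apply]
  field_simp
  norm_num
  ring

/-- First variation of the energy, before integration by parts. -/
theorem hasDerivAt_energy (α : ℝ) {a b : ℝ} (hab : a ≤ b) {y η p q : ℝ → ℝ}
    (hy : ContinuousOn y (Icc a b)) (hη : ContinuousOn η (Icc a b))
    (hp : ContinuousOn p (Icc a b)) (hq : ContinuousOn q (Icc a b))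
    (hpos : ∀ x ∈ Icc a b, 0 < y x) :
    HasDerivAt (fun t : ℝ => ∫ x in a..b,
        (y x + t * η x) ^ α * Real.sqrt (1 + (p x + t * q x) ^ 2))
      (∫ x in a..b, (α * y x ^ (α - 1) * η x * Real.sqrt (1 + p x ^ 2)
        + y x ^ α * (p x * q x / Real.sqrt (1 + p x ^ 2)))) 0 := by
  obtain ⟨x₀, hx₀, hmin⟩ := isCompact_Icc.exists_isMinOn (nonempty_Icc.2 hab) hy
  obtain ⟨C, hC⟩ := isCompact_Icc.exists_bound_of_continuousOn hη
  have hm := hpos x₀ hx₀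
  have hC0 : 0 ≤ C := (norm_nonneg _).trans (hC x₀ hx₀)
  have hε : 0 < y x₀ / (C + 1) := by positivity
  have hvar : ∀ x ∈ Icc a b, ∀ t ∈ Metric.closedBall (0 : ℝ) (y x₀ / (C + 1)),
      0 < y x + t * η x := by
    intro x hx t ht
    have ht' : |t| ≤ y x₀ / (C + 1) := by simpa using ht
    have h1 : |t * η x| ≤ y x₀ / (C + 1) * C := by
      rw [abs_mul]
      exact mul_le_mul ht' (hC x hx) (abs_nonneg _) hε.le
    have h2 : y x₀ / (C + 1) * C < y x₀ := by
      rw [div_mul_eq_mul_div, div_lt_iff₀ (by positivity)]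
      nlinarith
    have h3 : y x₀ ≤ y x := hmin hx
    have := neg_abs_le (t * η x)
    linarith
  have hw (t x : ℝ) : Real.sqrt (1 + (p x + t * q x) ^ 2) ≠ 0 :=
    (Real.sqrt_pos.2 (by positivity)).ne'
  have key := hasDerivAt_intervalIntegral_of_continuousOn (t₀ := 0) hab hε
    (F := fun t x => (y x + t * η x) ^ α * Real.sqrt (1 + (p x + t * q x) ^ 2))
    (F' := fun t x => α * (y x + t * η x) ^ (α - 1) * η x * Real.sqrt (1 + (p x + t * q x) ^ 2)
        + (y x + t * η x) ^ α * ((p x + t * q x) * q x / Real.sqrt (1 + (p x + t * q x) ^ 2)))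
    ?_ ?_ fun x hx t ht => hasDerivAt_energy_density α _ _ _ _ _ (hvar x hx t ht)
  · simpa using key
  · intro t ht
    have h1 : ContinuousOn (fun x => (y x + t * η x) ^ α) (Icc a b) :=
      ContinuousOn.rpow_const (by fun_prop) fun x hx => Or.inl (hvar x hx t ht).ne'
    fun_prop
  · have hsnd {f : ℝ → ℝ} (hf : ContinuousOn f (Icc a b)) : ContinuousOn (fun z : ℝ × ℝ => f z.2)
        (Metric.closedBall (0 : ℝ) (y x₀ / (C + 1)) ×ˢ Icc a b) :=
      hf.comp continuousOn_snd fun z hz => hz.2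
    have hy := hsnd hy
    have hη := hsnd hη
    have hp := hsnd hp
    have hq := hsnd hq
    have hr (β : ℝ) : ContinuousOn (fun z : ℝ × ℝ => (y z.2 + z.1 * η z.2) ^ β)
        (Metric.closedBall (0 : ℝ) (y x₀ / (C + 1)) ×ˢ Icc a b) :=
      (hy.add (continuousOn_fst.mul hη)).rpow_const fun z hz => Or.inl (hvar z.2 hz.2 z.1 hz.1).ne'
    have h1 := hr α
    have h2 := hr (α - 1)
    have h3 : ContinuousOn (fun z : ℝ × ℝ => Real.sqrt (1 + (p z.2 + z.1 * q z.2) ^ 2))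
        (Metric.closedBall (0 : ℝ) (y x₀ / (C + 1)) ×ˢ Icc a b) :=
      (continuousOn_const.add ((hp.add (continuousOn_fst.mul hq)).pow 2)).sqrt
    exact (((continuousOn_const.mul h2).mul hη).mul h3).add
      (h1.mul (((hp.add (continuousOn_fst.mul hq)).mul hq).div h3 fun z _ => hw z.1 z.2))

/-- The first variation after integration by parts: the Euler–Lagrange form. -/
theorem integral_first_variation (α : ℝ) {a b : ℝ} (hab : a ≤ b) {y η p q r : ℝ → ℝ}
    (hy : ContinuousOn y (Icc a b)) (hη : ContinuousOn η (Icc a b))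
    (hp : ContinuousOn p (Icc a b)) (hq : ContinuousOn q (Icc a b))
    (hr : ContinuousOn r (Icc a b))
    (hy' : ∀ x ∈ Ioo a b, HasDerivAt y (p x) x) (hη' : ∀ x ∈ Ioo a b, HasDerivAt η (q x) x)
    (hp' : ∀ x ∈ Ioo a b, HasDerivAt p (r x) x)
    (hpos : ∀ x ∈ Icc a b, 0 < y x) (ha : η a = 0) (hb : η b = 0) :
    ∫ x in a..b, (α * y x ^ (α - 1) * η x * Real.sqrt (1 + p x ^ 2)
        + y x ^ α * (p x * q x / Real.sqrt (1 + p x ^ 2))) =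
      ∫ x in a..b, η x * (y x ^ (α - 1) / Real.sqrt (1 + p x ^ 2) ^ 3
        * (α * (1 + p x ^ 2) - r x * y x)) := by
  have hw (x : ℝ) : Real.sqrt (1 + p x ^ 2) ≠ 0 := (Real.sqrt_pos.2 (by positivity)).ne'
  have hrpow (β : ℝ) : ContinuousOn (fun x => y x ^ β) (Icc a b) :=
    hy.rpow_const fun x hx => Or.inl (hpos x hx).ne'
  have h1 := hrpow α
  have h2 := hrpow (α - 1)
  have h3 : ContinuousOn (fun x => Real.sqrt (1 + p x ^ 2)) (Icc a b) := by fun_prop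
  have hL : ContinuousOn (fun x => α * y x ^ (α - 1) * η x * Real.sqrt (1 + p x ^ 2)
      + y x ^ α * (p x * q x / Real.sqrt (1 + p x ^ 2))) (Icc a b) :=
    (((continuousOn_const.mul h2).mul hη).mul h3).add (h1.mul ((hp.mul hq).div h3 fun x _ => hw x))
  have hR : ContinuousOn (fun x => η x * (y x ^ (α - 1) / Real.sqrt (1 + p x ^ 2) ^ 3
        * (α * (1 + p x ^ 2) - r x * y x))) (Icc a b) :=
    hη.mul ((h2.div (h3.pow 3) fun x _ => pow_ne_zero 3 (hw x)).mul (by fun_prop))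
  have hLi := hL.intervalIntegrable_of_Icc (μ := MeasureTheory.volume) hab
  have hRi := hR.intervalIntegrable_of_Icc (μ := MeasureTheory.volume) hab
  rw [← sub_eq_zero, ← intervalIntegral.integral_sub hLi hRi]
  rw [intervalIntegral.integral_eq_sub_of_hasDerivAt_of_le hab
    (f := fun x => y x ^ α * (p x / Real.sqrt (1 + p x ^ 2)) * η x)
    ((h1.mul (hp.div h3 fun x _ => hw x)).mul hη) ?_ (hLi.sub hRi)]
  · simp [ha, hb]
  · intro x hx
    have hyx := hpos x (Ioo_subset_Icc_self hx)
    have hwpos : (0 : ℝ) < 1 + p x ^ 2 := by positivity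
    have d1 := (hy' x hx).rpow_const (p := α) (Or.inl hyx.ne')
    have d2 := (((hp' x hx).pow 2).const_add 1).sqrt hwpos.ne'
    refine ((d1.mul ((hp' x hx).div d2 (hw x))).mul (hη' x hx)).congr_deriv ?_
    have hs : Real.sqrt (1 + p x ^ 2) ^ 2 = 1 + p x ^ 2 := Real.sq_sqrt hwpos.le
    have hya : y x ^ α = y x ^ (α - 1) * y x := by
      rw [Real.rpow_sub_one hyx.ne']; field_simp
    have hwx := hw x
    simp only [Pi.pow_apply, Pi.mul_apply, Pi.div_apply]
    rw [hya]
    generalize Real.sqrt (1 + p x ^ 2) = w at *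
    field_simp
    norm_num
    linear_combination 2 * η x * (y x * r x - α * (1 + w ^ 2)) * hs

/-- a smooth positive `y` on `[a,b]` satisfies the Euclidean α-catenary
equation iff the graph of `y` is a stationary point of the potential α-energy
`𝓔₀[y] = ∫_a^b y^α √(1+y'²) dx` for every smooth variation vanishing at the endpoints. -/
theorem statement_11 (α a b : ℝ) (hab : a < b) (y : ℝ → ℝ)
    (hy : ContDiffOn ℝ (⊤ : ℕ∞) y (Set.Icc a b)) (hypos : ∀ x ∈ Set.Icc a b, 0 < y x) :
    (∀ x ∈ Set.Icc a b,
      derivWithin (derivWithin y (Set.Icc a b)) (Set.Icc a b) x * y x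
        = α * (1 + (derivWithin y (Set.Icc a b) x) ^ 2)) ↔
    (∀ η : ℝ → ℝ, ContDiffOn ℝ (⊤ : ℕ∞) η (Set.Icc a b) → η a = 0 → η b = 0 →
      HasDerivAt (fun t : ℝ => ∫ x in a..b,
        (y x + t * η x) ^ α
          * Real.sqrt (1 + (derivWithin y (Set.Icc a b) x
              + t * derivWithin η (Set.Icc a b) x) ^ 2)) 0 0) := by
  have hI := uniqueDiffOn_Icc hab
  have hdiff {f : ℝ → ℝ} (hf : ContDiffOn ℝ (⊤ : ℕ∞) f (Icc a b)) :
      ContDiffOn ℝ (⊤ : ℕ∞) (derivWithin f (Icc a b)) (Icc a b) :=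
    hf.derivWithin hI (by simp)
  have hder {f : ℝ → ℝ} (hf : ContDiffOn ℝ (⊤ : ℕ∞) f (Icc a b)) :
      ∀ x ∈ Ioo a b, HasDerivAt f (derivWithin f (Icc a b) x) x := fun x hx =>
    ((hf.differentiableOn (by simp)) x (Ioo_subset_Icc_self hx)).hasDerivWithinAt.hasDerivAt
      (Icc_mem_nhds hx.1 hx.2)
  have hp := hdiff hy
  have hr := hdiff hp
  set p := derivWithin y (Icc a b)
  set r := derivWithin p (Icc a b)
  have hfirst (η : ℝ → ℝ) (hη : ContDiffOn ℝ (⊤ : ℕ∞) η (Icc a b)) (ha : η a = 0) (hb : η b = 0) :=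
    integral_first_variation α hab.le hy.continuousOn hη.continuousOn hp.continuousOn
      (hdiff hη).continuousOn hr.continuousOn (hder hy) (hder hη) (hder hp) hypos ha hb ▸
    hasDerivAt_energy α hab.le hy.continuousOn hη.continuousOn hp.continuousOn
      (hdiff hη).continuousOn hypos
  constructor
  · intro hEL η hη ha hb
    refine (hfirst η hη ha hb).congr_deriv ?_
    refine (intervalIntegral.integral_congr fun x hx => ?_).trans intervalIntegral.integral_zero
    rw [uIcc_of_le hab.le] at hx
    simp [hEL x hx]
  · intro hstat
    have hR : ContDiffOn ℝ (⊤ : ℕ∞) (fun x => α * (1 + p x ^ 2) - r x * y x) (Icc a b) :=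
      (contDiffOn_const.mul (contDiffOn_const.add (hp.pow 2))).sub (hr.mul hy)
    have hη : ContDiffOn ℝ (⊤ : ℕ∞)
        (fun x => (x - a) * (b - x) * (α * (1 + p x ^ 2) - r x * y x)) (Icc a b) :=
      ContDiffOn.mul (by fun_prop) hR
    have hzero := (hfirst _ hη (by simp) (by simp)).unique (hstat _ hη (by simp) (by simp))
    have hw (x : ℝ) : 0 < Real.sqrt (1 + p x ^ 2) := Real.sqrt_pos.2 (by positivity)
    have hcoef : ∀ x ∈ Icc a b, 0 < y x ^ (α - 1) / Real.sqrt (1 + p x ^ 2) ^ 3 := fun x hx =>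
      div_pos (Real.rpow_pos_of_pos (hypos x hx) _) (pow_pos (hw x) 3)
    have hcont : ContinuousOn (fun x => (x - a) * (b - x) * (α * (1 + p x ^ 2) - r x * y x)
        * (y x ^ (α - 1) / Real.sqrt (1 + p x ^ 2) ^ 3 * (α * (1 + p x ^ 2) - r x * y x)))
        (Icc a b) := by
      have hpc := hp.continuousOn
      refine hη.continuousOn.mul (ContinuousOn.mul (ContinuousOn.div ?_ ?_ fun x _ =>
        (pow_pos (hw x) 3).ne') hR.continuousOn)
      · exact hy.continuousOn.rpow_const fun x hx => Or.inl (hypos x hx).ne'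
      · fun_prop
    have hIoo : EqOn (fun x => α * (1 + p x ^ 2) - r x * y x) (fun _ => 0) (Ioo a b) := by
      intro x hx
      by_contra hne
      refine (intervalIntegral.integral_pos hab hcont (fun z hz => ?_)
        ⟨x, Ioo_subset_Icc_self hx, ?_⟩).ne' hzero
      · have h1 := hcoef z (Ioc_subset_Icc_self hz)
        have h2 : 0 ≤ (z - a) * (b - z) :=
          mul_nonneg (sub_nonneg.2 hz.1.le) (sub_nonneg.2 hz.2)
        have := mul_nonneg (mul_nonneg h2 h1.le) (sq_nonneg (α * (1 + p z ^ 2) - r z * y z))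
        linarith
      · have h1 := hcoef x (Ioo_subset_Icc_self hx)
        have h2 : 0 < (x - a) * (b - x) := mul_pos (sub_pos.2 hx.1) (sub_pos.2 hx.2)
        have := mul_pos (mul_pos h2 h1) (sq_pos_of_ne_zero hne)
        linarith
    have hIcc := hIoo.of_subset_closure hR.continuousOn continuousOn_const Ioo_subset_Icc_self
      (closure_Ioo hab.ne).ge
    intro x hx
    exact (sub_eq_zero.1 (hIcc hx)).symm
end

section
/- Let α, v ∈ ℝ, c > 0, let I ⊆ ℝ be a nonempty open interval, and let y, z : I → ℝ be smooth with y(x) > 0, where y satisfies y''(x)·y(x) = α·(1 + y'(x)²) and 1 + y'(x)² = c²·y(x)^(2α) on I. Then the identity d/dx [ z'(x)/c + α·(z(x) + v·x)·y(x)^(α−1)·y'(x)/√(1 + y'(x)²) ] = α·(α−1)·(z(x) + v·x)·y(x)^(α−2)·√(1 + y'(x)²) holds for all x ∈ I if and only if z satisfies the dual α-catenary equation z''(x) + α·(y'(x)/y(x))·(z'(x) + v) + α·(z(x) + v·x)/y(x)² = 0 for all x ∈ I. -/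
/-- Along a positive function with first integral `1 + p ^ 2 = c ^ 2 * Y ^ (2 * α)`,
the arc length element is `c * Y ^ α`. -/
lemma sqrt_one_add_sq_of_first_integral {α c p Y : ℝ} (hc : 0 < c) (hY : 0 < Y)
    (h : 1 + p ^ 2 = c ^ 2 * Y ^ (2 * α)) : Real.sqrt (1 + p ^ 2) = c * Y ^ α := by
  have hpow : Y ^ (2 * α) = (Y ^ α) ^ 2 := by
    rw [mul_comm, Real.rpow_mul hY.le, Real.rpow_two]
  rw [h, hpow, ← mul_pow, Real.sqrt_sq (by positivity)]

/-- A smooth function on an open set has a derivative and a second derivative there. -/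
lemma ContDiffOn.hasDerivAt_and_hasDerivAt_deriv {f : ℝ → ℝ} {s : Set ℝ} {x : ℝ}
    (hf : ContDiffOn ℝ (⊤ : ℕ∞) f s) (hs : IsOpen s) (hx : x ∈ s) :
    HasDerivAt f (deriv f x) x ∧ HasDerivAt (deriv f) (deriv (deriv f) x) x := by
  have hf' : ContDiffOn ℝ 1 (deriv f) s := hf.deriv_of_isOpen hs (by
    norm_num; exact WithTop.coe_le_coe.mpr (le_top (a := (2 : ℕ∞))))
  have hsx := hs.mem_nhds hx
  exact ⟨((hf.differentiableOn (by simp)).differentiableAt hsx).hasDerivAt,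
    ((hf'.differentiableOn (by simp)).differentiableAt hsx).hasDerivAt⟩

/-- the first Euler–Lagrange equation of the constrained dual energy
(with Lagrange multiplier `λ = 1/c`) is equivalent to the dual α-catenary equation. -/
theorem statement_13 (α v c : ℝ) (hc : 0 < c) (I : Set ℝ)
    (hIopen : IsOpen I) (hIne : I.Nonempty) (hIord : I.OrdConnected)
    (y z : ℝ → ℝ) (hy : ContDiffOn ℝ (⊤ : ℕ∞) y I) (hz : ContDiffOn ℝ (⊤ : ℕ∞) z I)
    (hypos : ∀ x ∈ I, 0 < y x)
    (hcat : ∀ x ∈ I, deriv (deriv y) x * y x = α * (1 + (deriv y x) ^ 2))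
    (hfirst : ∀ x ∈ I, 1 + (deriv y x) ^ 2 = c ^ 2 * y x ^ (2 * α)) :
    (∀ x ∈ I,
      deriv (fun t => deriv z t / c
          + α * (z t + v * t) * y t ^ (α - 1) * deriv y t
            / Real.sqrt (1 + (deriv y t) ^ 2)) x
        = α * (α - 1) * (z x + v * x) * y x ^ (α - 2)
            * Real.sqrt (1 + (deriv y x) ^ 2)) ↔
    (∀ x ∈ I, deriv (deriv z) x + α * (deriv y x / y x) * (deriv z x + v)
        + α * (z x + v * x) / (y x) ^ 2 = 0) := by
  refine forall₂_congr fun x hx => ?_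
  obtain ⟨hy₁, hy₂⟩ := hy.hasDerivAt_and_hasDerivAt_deriv hIopen hx
  obtain ⟨hz₁, hz₂⟩ := hz.hasDerivAt_and_hasDerivAt_deriv hIopen hx
  have hY := hypos x hx
  have hcongr : (fun t => deriv z t / c
      + α * (z t + v * t) * y t ^ (α - 1) * deriv y t / Real.sqrt (1 + (deriv y t) ^ 2))
      =ᶠ[nhds x] fun t => deriv z t / c + α * (z t + v * t) * deriv y t / (c * y t) := by
    filter_upwards [hIopen.mem_nhds hx] with t ht
    have hYt := hypos t ht
    rw [sqrt_one_add_sq_of_first_integral hc hYt (hfirst t ht), Real.rpow_sub_one hYt.ne']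
    have := Real.rpow_pos_of_pos hYt α
    field_simp
  have hderiv := (hz₂.div_const c).add
    ((((hz₁.add ((hasDerivAt_id x).const_mul v)).const_mul α).mul hy₂).div
      (hy₁.const_mul c) (by positivity))
  have hy'' : deriv (deriv y) x = α * (1 + deriv y x ^ 2) / y x :=
    eq_div_of_mul_eq hY.ne' (hcat x hx)
  have hrhs : α * (α - 1) * (z x + v * x) * y x ^ (α - 2) * Real.sqrt (1 + deriv y x ^ 2)
      = α * (α - 1) * (z x + v * x) * (1 + deriv y x ^ 2) / (c * y x ^ 2) := by
    have hsqrt := sqrt_one_add_sq_of_first_integral hc hY (hfirst x hx)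
    have hsq : 1 + deriv y x ^ 2 = (c * y x ^ α) ^ 2 := by
      rw [← hsqrt, Real.sq_sqrt (by positivity)]
    rw [hsqrt, hsq, Real.rpow_sub hY, Real.rpow_two]
    field_simp
  rw [hcongr.deriv_eq, hrhs]
  refine Eq.congr_left (hderiv.deriv) |>.trans ?_
  rw [hy'', ← sub_eq_zero, ← mul_right_inj' hc.ne', mul_zero]
  refine Eq.congr_left ?_
  simp only [Pi.add_apply, Pi.mul_apply, id]
  field_simp
  ring
end
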